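/- arXiv:2207.04522 — 3 statements merged into one kernel-verified Lean document; each statement's English description precedes it below -/
import Mathlib

section
/- Let α = 2√7 − 4 and fix ε > 0. Let W be a balanced tetrahedral erasure channel with 0 < H(W) < 1 and Q(W) ≤ α − ε. Then there exists an integer m > 0 such that for every n ≥ m and every string c ∈ {s,p}^n, the n-th-generation descendant W^c satisfies Q(W^c) ≥ Q(W)·(1 + ε/8). -/
noncomputable section

/-- A quintuple of reals representing a candidate tetrahedral erasure channel
`W = (p, q, r, s, t)`. -/
structure TECQuint where
  p : ℝ
  q : ℝ
  r : ℝ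
  s : ℝ
  t : ℝ

namespace TECQuint

/-- `W` is a tetrahedral erasure channel: all five entries are nonnegative and sum to 1. -/
def IsTEC (W : TECQuint) : Prop :=
  0 ≤ W.p ∧ 0 ≤ W.q ∧ 0 ≤ W.r ∧ 0 ≤ W.s ∧ 0 ≤ W.t ∧
    W.p + W.q + W.r + W.s + W.t = 1

/-- `W` is balanced: `q = r = s`. -/
def Balanced (W : TECQuint) : Prop := W.q = W.r ∧ W.r = W.s

/-- The serial child `W^s`. -/
def ser (W : TECQuint) : TECQuint where
  p := W.p ^ 2
  q := W.p * W.s + W.s * W.q + W.q * W.p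
  r := W.p * W.q + W.q * W.r + W.r * W.p
  s := W.p * W.r + W.r * W.s + W.s * W.p
  t := 1 - (W.p ^ 2 + (W.p * W.s + W.s * W.q + W.q * W.p)
      + (W.p * W.q + W.q * W.r + W.r * W.p)
      + (W.p * W.r + W.r * W.s + W.s * W.p))

/-- The parallel child `W^p`. -/
def par (W : TECQuint) : TECQuint where
  p := 1 - ((W.t * W.s + W.s * W.q + W.q * W.t)
      + (W.t * W.q + W.q * W.r + W.r * W.t)
      + (W.t * W.r + W.r * W.s + W.s * W.t) + W.t ^ 2)
  q := W.t * W.s + W.s * W.q + W.q * W.t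
  r := W.t * W.q + W.q * W.r + W.r * W.t
  s := W.t * W.r + W.r * W.s + W.s * W.t
  t := W.t ^ 2

/-- The moment of inertia `A(W) = (q−r)² + (r−s)² + (s−q)²`. -/
def inertia (W : TECQuint) : ℝ :=
  (W.q - W.r) ^ 2 + (W.r - W.s) ^ 2 + (W.s - W.q) ^ 2

/-- The (conditional) entropy `H(W) = (q+r+s)/2 + t`. -/
def entropy (W : TECQuint) : ℝ := (W.q + W.r + W.s) / 2 + W.t

/-- The edge mass `E(W) = q + r + s`. -/
def edgeMass (W : TECQuint) : ℝ := W.q + W.r + W.s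

/-- The Quetelet index `Q(W) = E(W) / (H(W)(1−H(W)))`. -/
def quetelet (W : TECQuint) : ℝ :=
  edgeMass W / (entropy W * (1 - entropy W))

/-- One step of the channel process: `true` picks the serial child, `false` the parallel child. -/
def child (W : TECQuint) (b : Bool) : TECQuint := if b then ser W else par W

/-- The descendant `W^c` of `W` along the string `c ∈ {s,p}^n`. -/
def descend : TECQuint → {n : ℕ} → (Fin n → Bool) → TECQuint
  | W, 0, _ => W
  | W, _ + 1, c => descend (child W (c 0)) (fun i => c i.succ)

end TECQuint

open TECQuint

namespace TECQuint

lemma core_grow (Q G H κ : ℝ) (hGH : G + H = 1) (hG : 0 < G) (hH : 0 < H) (hQ : 0 ≤ Q)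
    (hκ : 0 ≤ κ) (hb : Q ^ 2 + 8 * Q ≤ 12 - κ) :
    Q * (1 + H * κ / 24) * ((G ^ 2 - (Q * G * H) ^ 2 / 12) * (1 - (G ^ 2 - (Q * G * H) ^ 2 / 12)))
      ≤ 2 * (Q * G * H) * (G - (Q * G * H) / 3) := by
  obtain rfl : G = 1 - H := by linarith
  have hQ2 : Q ≤ 3 / 2 := by nlinarith
  set B := 2 - H + Q ^ 2 * (1 - H) ^ 2 * H / 12 with hB
  set A := 1 - (Q * H) ^ 2 / 12 with hA
  have hH1 : H < 1 := by linarith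
  have hQQ : Q ^ 2 ≤ 9 / 4 := by nlinarith
  have hB0 : 0 ≤ B := by
    have : 0 ≤ Q ^ 2 * (1 - H) ^ 2 * H := by positivity
    rw [hB]; linarith
  have hG2 : (1 - H) ^ 2 ≤ 1 := by nlinarith
  have hQG : Q ^ 2 * (1 - H) ^ 2 ≤ Q ^ 2 := by nlinarith [sq_nonneg Q]
  have hB1 : B ≤ 2 - H + Q ^ 2 * H / 12 := by
    rw [hB]; nlinarith
  have hB2 : B ≤ 2 := by nlinarith
  have hA1 : A ≤ 1 := by rw [hA]; nlinarith [sq_nonneg (Q * H)]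
  have hAB : A * B ≤ 2 := by nlinarith
  have hAB2 : A * B ≤ B := by nlinarith
  have key : (1 + H * κ / 24) * (A * B) ≤ 2 * (1 - Q * H / 3) := by
    have hHκ : 0 ≤ H * κ / 24 := by positivity
    have h1 : H * κ / 24 * (A * B) ≤ H * κ / 24 * 2 := by gcongr
    have h2 : H * (Q ^ 2 + 8 * Q) ≤ H * (12 - κ) := by gcongr
    nlinarith
  have hm : 0 ≤ Q * (1 - H) ^ 2 * H := by positivity
  have := mul_le_mul_of_nonneg_left key hm
  calc _ = Q * (1 - H) ^ 2 * H * ((1 + H * κ / 24) * (A * B)) := by rw [hA, hB]; ring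
    _ ≤ _ := this
    _ = _ := by ring

lemma core_interp (b G H E E1 : ℝ) (hGH : G + H = 1) (hG : 0 < G) (hH : 0 < H) (hb0 : 0 ≤ b)
    (hb : b ^ 2 + 8 * b ≤ 12) (hE : b * G * H ≤ E) (hE1 : E ≤ E1) (h1 : E1 ≤ 1)
    (hf : b * ((G ^ 2 - E1 ^ 2 / 12) * (1 - (G ^ 2 - E1 ^ 2 / 12))) ≤ 2 * E1 * (G - E1 / 3)) :
    b * ((G ^ 2 - E ^ 2 / 12) * (1 - (G ^ 2 - E ^ 2 / 12))) ≤ 2 * E * (G - E / 3) := by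
  have hb2 : b ≤ 3 / 2 := by nlinarith
  have h0 := core_grow b G H 0 hGH hG hH hb0 le_rfl (by linarith)
  simp only [mul_zero, zero_div, add_zero, mul_one] at h0
  have hE0n : 0 ≤ b * G * H := by positivity
  set E0 := b * G * H with hE0
  rcases eq_or_lt_of_le (hE.trans hE1) with h | h
  · obtain rfl : E = E1 := by linarith
    exact hf
  have hstuff : 0 ≤ 2 / 3 + b * (2 * G ^ 2 - 1) / 12
      - b / 144 * (E ^ 2 + E0 ^ 2 + E1 ^ 2 + E * E0 + E * E1 + E0 * E1) := by
    have hs : E ^ 2 + E0 ^ 2 + E1 ^ 2 + E * E0 + E * E1 + E0 * E1 ≤ 6 := by nlinarith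
    have h3 := mul_le_mul_of_nonneg_left hs hb0
    have h4 : 0 ≤ b * G ^ 2 := by positivity
    nlinarith
  have hp : 0 ≤ (E - E0) * (E1 - E) * (E1 - E0) := by
    apply mul_nonneg (mul_nonneg _ _) <;> linarith
  have hp2 := mul_nonneg hp hstuff
  have ha := mul_le_mul_of_nonneg_right h0 (show 0 ≤ E1 - E by linarith)
  have hb' := mul_le_mul_of_nonneg_right hf (show 0 ≤ E - E0 by linarith)
  have hpos : 0 < E1 - E0 := by linarith
  refine le_of_mul_le_mul_right ?_ hpos
  clear_value E0
  linarith

lemma core_inv (b G H E : ℝ) (hGH : G + H = 1) (hG : 0 < G) (hH : 0 < H) (hb0 : 0 ≤ b)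
    (hb : b ^ 2 + 8 * b ≤ 12) (hE : b * G * H ≤ E) (hEG : E ≤ 2 * G) (hEH : E ≤ 2 * H) :
    b * ((G ^ 2 - E ^ 2 / 12) * (1 - (G ^ 2 - E ^ 2 / 12))) ≤ 2 * E * (G - E / 3) := by
  have hb2 : b ≤ 3 / 2 := by nlinarith
  rcases le_total G H with h | h
  · refine core_interp b G H E (2 * G) hGH hG hH hb0 hb hE hEG (by linarith) ?_
    have h1 : b * (1 - 2 * G ^ 2 / 3) ≤ 2 := by nlinarith [mul_nonneg hb0 (sq_nonneg G)]
    have := mul_le_mul_of_nonneg_left h1 (show 0 ≤ 2 * G ^ 2 / 3 by positivity)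
    linarith
  · refine core_interp b G H E (2 * H) hGH hG hH hb0 hb hE hEH (by linarith) ?_
    obtain rfl : G = 1 - H := by linarith
    have hA : 0 ≤ (1 - H / 3) * (1 - 2 * H + 2 * H ^ 2 / 3) :=
      mul_nonneg (by linarith) (by nlinarith)
    have h1 : b * ((1 - H / 3) * (1 - 2 * H + 2 * H ^ 2 / 3)) ≤
        2 * ((1 - H / 3) * (1 - 2 * H + 2 * H ^ 2 / 3)) := by
      apply mul_le_mul_of_nonneg_right _ hA; linarith
    have h2 : (1 - H / 3) * (1 - 2 * H + 2 * H ^ 2 / 3) ≤ 1 - 5 * H / 3 := by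
      have h3 : 0 ≤ H * (1 - 2 * H) := mul_nonneg hH.le (by linarith)
      have h4 : 0 ≤ H ^ 3 := by positivity
      nlinarith
    have := mul_le_mul_of_nonneg_left (h1.trans (mul_le_mul_of_nonneg_left h2 zero_le_two))
      (show 0 ≤ 2 * H by linarith)
    linarith

/-- Valid balanced channels. -/
def Val (W : TECQuint) : Prop :=
  W.Balanced ∧ W.p + W.q + W.r + W.s + W.t = 1 ∧ 0 < entropy W ∧ entropy W < 1 ∧
  0 ≤ edgeMass W ∧ edgeMass W ≤ 2 * (1 - entropy W) ∧ edgeMass W ≤ 2 * entropy W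

lemma core_val (G H E : ℝ) (hGH : G + H = 1) (hG : 0 < G) (hH : 0 < H) (hE : 0 ≤ E)
    (hEG : E ≤ 2 * G) (hEH : E ≤ 2 * H) :
    0 < G ^ 2 - E ^ 2 / 12 ∧ G ^ 2 - E ^ 2 / 12 < 1 ∧ 0 ≤ 2 * E * (G - E / 3) ∧
    2 * E * (G - E / 3) ≤ 2 * (G ^ 2 - E ^ 2 / 12) ∧
    2 * E * (G - E / 3) ≤ 2 * (1 - (G ^ 2 - E ^ 2 / 12)) ∧
    H * (2 - H) ≤ 1 - (G ^ 2 - E ^ 2 / 12) ∧ 1 - (G ^ 2 - E ^ 2 / 12) ≤ 2 * H := by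
  obtain rfl : G = 1 - H := by linarith
  refine ⟨by nlinarith, by nlinarith, mul_nonneg (by linarith) (by linarith), ?_, ?_, ?_, ?_⟩
  · nlinarith [sq_nonneg (1 - H - E / 2)]
  · nlinarith [mul_nonneg hG.le (sub_nonneg.2 hEH), mul_nonneg hH.le hH.le, sq_nonneg E]
  · nlinarith [sq_nonneg E]
  · nlinarith

lemma ser_eq (W : TECQuint) (h : Val W) : (ser W).Balanced ∧
    (ser W).p + (ser W).q + (ser W).r + (ser W).s + (ser W).t = 1 ∧
    edgeMass (ser W) = 2 * edgeMass W * ((1 - entropy W) - edgeMass W / 3) ∧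
    entropy (ser W) = 1 - ((1 - entropy W) ^ 2 - edgeMass W ^ 2 / 12) := by
  obtain ⟨⟨h1, h2⟩, hs, -⟩ := h
  obtain ⟨p, q, r, s, t⟩ := W
  simp only at h1 h2 hs
  subst h1 h2
  obtain rfl : p = 1 - 3 * q - t := by linarith
  refine ⟨⟨?_, ?_⟩, ?_, ?_, ?_⟩ <;> simp only [ser, edgeMass, entropy] <;> ring

lemma par_eq (W : TECQuint) (h : Val W) : (par W).Balanced ∧
    (par W).p + (par W).q + (par W).r + (par W).s + (par W).t = 1 ∧
    edgeMass (par W) = 2 * edgeMass W * (entropy W - edgeMass W / 3) ∧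
    entropy (par W) = entropy W ^ 2 - edgeMass W ^ 2 / 12 := by
  obtain ⟨⟨h1, h2⟩, hs, -⟩ := h
  obtain ⟨p, q, r, s, t⟩ := W
  simp only at h1 h2 hs
  subst h1 h2
  obtain rfl : p = 1 - 3 * q - t := by linarith
  refine ⟨⟨?_, ?_⟩, ?_, ?_, ?_⟩ <;> simp only [par, edgeMass, entropy] <;> ring

lemma ser_val (W : TECQuint) (h : Val W) : Val (ser W) ∧
    entropy W * (2 - entropy W) ≤ entropy (ser W) ∧ entropy (ser W) ≤ 2 * entropy W := by
  obtain ⟨a1, a2, a3, a4⟩ := ser_eq W h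
  obtain ⟨-, -, h0, h1, hE, hEG, hEH⟩ := h
  obtain ⟨c1, c2, c3, c4, c5, c6, c7⟩ := core_val (1 - entropy W) (entropy W) (edgeMass W)
    (by ring) (by linarith) h0 hE hEG hEH
  refine ⟨⟨a1, a2, ?_, ?_, ?_, ?_, ?_⟩, ?_, ?_⟩ <;> (try rw [a3]) <;> (try rw [a4]) <;> linarith

lemma par_val (W : TECQuint) (h : Val W) : Val (par W) ∧
    (1 - entropy W) * (1 + entropy W) ≤ 1 - entropy (par W) ∧
    1 - entropy (par W) ≤ 2 * (1 - entropy W) := by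
  obtain ⟨a1, a2, a3, a4⟩ := par_eq W h
  obtain ⟨-, -, h0, h1, hE, hEG, hEH⟩ := h
  obtain ⟨c1, c2, c3, c4, c5, c6, c7⟩ := core_val (entropy W) (1 - entropy W) (edgeMass W)
    (by ring) h0 (by linarith) hE hEH hEG
  refine ⟨⟨a1, a2, ?_, ?_, ?_, ?_, ?_⟩, ?_, ?_⟩ <;> (try rw [a3]) <;> (try rw [a4]) <;> linarith

lemma le_quet (W : TECQuint) (h : Val W) (b : ℝ) :
    b ≤ quetelet W ↔ b * (entropy W * (1 - entropy W)) ≤ edgeMass W := by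
  have := mul_pos h.2.2.1 (sub_pos.2 h.2.2.2.1)
  rw [quetelet, le_div_iff₀ this]

lemma quet_eq (W : TECQuint) (h : Val W) :
    edgeMass W = quetelet W * (entropy W * (1 - entropy W)) := by
  have := mul_pos h.2.2.1 (sub_pos.2 h.2.2.2.1)
  rw [quetelet, div_mul_cancel₀ _ this.ne']

lemma quet_nonneg (W : TECQuint) (h : Val W) : 0 ≤ quetelet W := by
  rw [le_quet W h]; linarith [h.2.2.2.2.1]

lemma ser_inv (W : TECQuint) (h : Val W) (b : ℝ) (hb0 : 0 ≤ b) (hb : b ^ 2 + 8 * b ≤ 12)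
    (hQ : b ≤ quetelet W) : b ≤ quetelet (ser W) := by
  rw [le_quet _ (ser_val W h).1]
  rw [le_quet _ h] at hQ
  obtain ⟨a1, a2, a3, a4⟩ := ser_eq W h
  obtain ⟨-, -, h0, h1, hE, hEG, hEH⟩ := h
  have := core_inv b (1 - entropy W) (entropy W) (edgeMass W) (by ring) (by linarith) h0 hb0 hb
    (by linarith) hEG hEH
  rw [a3, a4]; linarith

lemma par_inv (W : TECQuint) (h : Val W) (b : ℝ) (hb0 : 0 ≤ b) (hb : b ^ 2 + 8 * b ≤ 12)
    (hQ : b ≤ quetelet W) : b ≤ quetelet (par W) := by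
  rw [le_quet _ (par_val W h).1]
  rw [le_quet _ h] at hQ
  obtain ⟨a1, a2, a3, a4⟩ := par_eq W h
  obtain ⟨-, -, h0, h1, hE, hEG, hEH⟩ := h
  have := core_inv b (entropy W) (1 - entropy W) (edgeMass W) (by ring) h0 (by linarith) hb0 hb
    (by linarith) hEH hEG
  rw [a3, a4]; linarith

lemma ser_grow (W : TECQuint) (h : Val W) (κ : ℝ) (hκ : 0 ≤ κ)
    (hb : quetelet W ^ 2 + 8 * quetelet W ≤ 12 - κ) :
    quetelet W * (1 + entropy W * κ / 24) ≤ quetelet (ser W) := by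
  have hq := quet_nonneg W h
  have he := quet_eq W h
  rw [le_quet _ (ser_val W h).1]
  obtain ⟨a1, a2, a3, a4⟩ := ser_eq W h
  obtain ⟨-, -, h0, h1, hE, hEG, hEH⟩ := h
  have := core_grow (quetelet W) (1 - entropy W) (entropy W) κ (by ring) (by linarith) h0 hq hκ hb
  rw [show quetelet W * (1 - entropy W) * entropy W = edgeMass W by rw [he]; ring] at this
  rw [a3, a4]; linarith

lemma par_grow (W : TECQuint) (h : Val W) (κ : ℝ) (hκ : 0 ≤ κ)
    (hb : quetelet W ^ 2 + 8 * quetelet W ≤ 12 - κ) :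
    quetelet W * (1 + (1 - entropy W) * κ / 24) ≤ quetelet (par W) := by
  have hq := quet_nonneg W h
  have he := quet_eq W h
  rw [le_quet _ (par_val W h).1]
  obtain ⟨a1, a2, a3, a4⟩ := par_eq W h
  obtain ⟨-, -, h0, h1, hE, hEG, hEH⟩ := h
  have := core_grow (quetelet W) (entropy W) (1 - entropy W) κ (by ring) h0 (by linarith) hq hκ hb
  rw [show quetelet W * entropy W * (1 - entropy W) = edgeMass W by rw [he]; ring] at this
  rw [a3, a4]; linarith

/-- All descendants of `W` from some generation on have Quetelet index at least `β`. -/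
def Good (β : ℝ) (W : TECQuint) : Prop :=
  ∃ m : ℕ, ∀ n : ℕ, m ≤ n → ∀ c : Fin n → Bool, β ≤ quetelet (descend W c)

lemma good_step (β : ℝ) (W : TECQuint) (h1 : Good β (ser W)) (h2 : Good β (par W)) :
    Good β W := by
  obtain ⟨m1, h1⟩ := h1
  obtain ⟨m2, h2⟩ := h2
  refine ⟨max m1 m2 + 1, ?_⟩
  rintro (_ | n) hn c
  · omega
  · rw [descend, child]
    split_ifs
    · exact h1 n (by omega) _
    · exact h2 n (by omega) _

lemma good_zero (β : ℝ) (hb0 : 0 ≤ β) (hb : β ^ 2 + 8 * β ≤ 12) (W : TECQuint) (h : Val W)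
    (hQ : β ≤ quetelet W) : Good β W := by
  refine ⟨0, fun n _ => ?_⟩
  induction n generalizing W with
  | zero => intro c; exact hQ
  | succ n ih =>
    intro c
    rw [descend, child]
    split_ifs
    · exact ih _ (ser_val W h).1 (ser_inv W h β hb0 hb hQ) (by omega) _
    · exact ih _ (par_val W h).1 (par_inv W h β hb0 hb hQ) (by omega) _

lemma good_of_pow (β κ : ℝ) (hb0 : 0 ≤ β) (hκ : 0 ≤ κ) (hb : β ^ 2 + 8 * β ≤ 12 - κ) (k : ℕ) :
    ∀ W : TECQuint, Val W → β ≤ quetelet W * (1 + κ / 96) ^ k → Good β W := by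
  induction k with
  | zero =>
    intro W h hQ
    exact good_zero β hb0 (by linarith) W h (by simpa using hQ)
  | succ k ih =>
    have hpow : 0 ≤ (1 + κ / 96) ^ k := by positivity
    have hpow' : 0 ≤ (1 + κ / 96) ^ (k + 1) := by positivity
    have small : ∀ W, Val W → quetelet W < β →
        quetelet W ^ 2 + 8 * quetelet W ≤ 12 - κ := by
      intro W h hlt
      have := quet_nonneg W h
      nlinarith
    have serbig : ∀ W, Val W → quetelet W < β → β ≤ quetelet W * (1 + κ / 96) ^ (k + 1) →
        1 / 4 ≤ entropy W → Good β (ser W) := by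
      intro W h hlt hQ hH
      refine ih _ (ser_val W h).1 (hQ.trans ?_)
      rw [pow_succ', ← mul_assoc]
      refine mul_le_mul_of_nonneg_right (le_trans ?_ (ser_grow W h κ hκ (small W h hlt))) hpow
      refine mul_le_mul_of_nonneg_left ?_ (quet_nonneg W h)
      nlinarith
    have parbig : ∀ W, Val W → quetelet W < β → β ≤ quetelet W * (1 + κ / 96) ^ (k + 1) →
        1 / 4 ≤ 1 - entropy W → Good β (par W) := by
      intro W h hlt hQ hH
      refine ih _ (par_val W h).1 (hQ.trans ?_)
      rw [pow_succ', ← mul_assoc]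
      refine mul_le_mul_of_nonneg_right (le_trans ?_ (par_grow W h κ hκ (small W h hlt))) hpow
      refine mul_le_mul_of_nonneg_left ?_ (quet_nonneg W h)
      nlinarith
    have low : ∀ j : ℕ, ∀ W, Val W → β ≤ quetelet W * (1 + κ / 96) ^ (k + 1) →
        entropy W ≤ 1 / 2 → 1 / 4 ≤ entropy W * (7 / 4) ^ j → Good β W := by
      intro j
      induction j with
      | zero =>
        intro W h hQ hH hj
        rcases le_or_gt β (quetelet W) with hlt | hlt
        · exact good_zero β hb0 (by linarith) W h hlt
        · exact good_step β W (serbig W h hlt hQ (by simpa using hj))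
            (parbig W h hlt hQ (by linarith))
      | succ j ihj =>
        intro W h hQ hH hj
        rcases le_or_gt β (quetelet W) with hlt | hlt
        · exact good_zero β hb0 (by linarith) W h hlt
        refine good_step β W ?_ (parbig W h hlt hQ (by linarith))
        rcases le_or_gt (1 / 4) (entropy W) with h4 | h4
        · exact serbig W h hlt hQ h4
        obtain ⟨hv, e1, e2⟩ := ser_val W h
        refine ihj _ hv (hQ.trans ?_) (by linarith) (hj.trans ?_)
        · refine mul_le_mul_of_nonneg_right ?_ hpow'
          exact ser_inv W h _ (quet_nonneg W h) (by linarith [small W h hlt]) le_rfl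
        · rw [pow_succ', ← mul_assoc]
          refine mul_le_mul_of_nonneg_right (le_trans ?_ e1) (by positivity)
          have := h.2.2.1
          nlinarith
    have high : ∀ j : ℕ, ∀ W, Val W → β ≤ quetelet W * (1 + κ / 96) ^ (k + 1) →
        1 - entropy W ≤ 1 / 2 → 1 / 4 ≤ (1 - entropy W) * (7 / 4) ^ j → Good β W := by
      intro j
      induction j with
      | zero =>
        intro W h hQ hH hj
        rcases le_or_gt β (quetelet W) with hlt | hlt
        · exact good_zero β hb0 (by linarith) W h hlt
        · exact good_step β W (serbig W h hlt hQ (by linarith))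
            (parbig W h hlt hQ (by simpa using hj))
      | succ j ihj =>
        intro W h hQ hH hj
        rcases le_or_gt β (quetelet W) with hlt | hlt
        · exact good_zero β hb0 (by linarith) W h hlt
        refine good_step β W (serbig W h hlt hQ (by linarith)) ?_
        rcases le_or_gt (1 / 4) (1 - entropy W) with h4 | h4
        · exact parbig W h hlt hQ h4
        obtain ⟨hv, e1, e2⟩ := par_val W h
        refine ihj _ hv (hQ.trans ?_) (by linarith) (hj.trans ?_)
        · refine mul_le_mul_of_nonneg_right ?_ hpow'
          exact par_inv W h _ (quet_nonneg W h) (by linarith [small W h hlt]) le_rfl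
        · rw [pow_succ', ← mul_assoc]
          refine mul_le_mul_of_nonneg_right (le_trans ?_ e1) (by positivity)
          have := h.2.2.2.1
          nlinarith
    have ex : ∀ x : ℝ, 0 < x → ∃ j : ℕ, 1 / 4 ≤ x * (7 / 4) ^ j := by
      intro x hx
      obtain ⟨j, hj⟩ := pow_unbounded_of_one_lt (1 / 4 / x) (show (1 : ℝ) < 7 / 4 by norm_num)
      refine ⟨j, ?_⟩
      rw [div_lt_iff₀ hx] at hj
      linarith
    intro W h hQ
    rcases le_total (entropy W) (1 / 2) with hh | hh
    · obtain ⟨j, hj⟩ := ex _ h.2.2.1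
      exact low j W h hQ hh hj
    · obtain ⟨j, hj⟩ := ex (1 - entropy W) (by linarith [h.2.2.2.1])
      exact high j W h hQ (by linarith) hj

end TECQuint


theorem uniform_attraction (ε : ℝ) (hε : 0 < ε)
    (W : TECQuint) (hW : W.IsTEC) (hbal : W.Balanced)
    (h0 : 0 < entropy W) (h1 : entropy W < 1)
    (hQ : quetelet W ≤ (2 * Real.sqrt 7 - 4) - ε) :
    ∃ m : ℕ, 0 < m ∧ ∀ n : ℕ, m ≤ n → ∀ c : Fin n → Bool,
      quetelet W * (1 + ε / 8) ≤ quetelet (descend W c) := by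
  obtain ⟨p0, q0, r0, s0, t0, hs⟩ := hW
  have hv : Val W := by
    refine ⟨hbal, hs, h0, h1, ?_, ?_, ?_⟩ <;> simp only [edgeMass, entropy] <;> linarith
  have hq := quet_nonneg W hv
  suffices hG : Good (quetelet W * (1 + ε / 8)) W by
    obtain ⟨m, hm⟩ := hG
    exact ⟨m + 1, by omega, fun n hn c => hm n (by omega) c⟩
  have h7 : Real.sqrt 7 ^ 2 = 7 := Real.sq_sqrt (by norm_num)
  have h7' : Real.sqrt 7 ≤ 3 := by
    rw [Real.sqrt_le_left (by norm_num)]; norm_num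
  have hb0 : 0 ≤ quetelet W * (1 + ε / 8) := by positivity
  have hlt : quetelet W * (1 + ε / 8) < 2 * Real.sqrt 7 - 4 := by nlinarith
  have hκ : (quetelet W * (1 + ε / 8)) ^ 2 + 8 * (quetelet W * (1 + ε / 8)) < 12 := by
    nlinarith
  rcases eq_or_lt_of_le hq with hz | hz
  · exact good_zero _ hb0 hκ.le W hv (by rw [← hz]; simp)
  set β := quetelet W * (1 + ε / 8) with hβ
  have hη : 1 < 1 + (12 - (β ^ 2 + 8 * β)) / 96 := by linarith
  obtain ⟨k, hk⟩ := pow_unbounded_of_one_lt (β / quetelet W) hη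
  refine good_of_pow β (12 - (β ^ 2 + 8 * β)) hb0 (by linarith) (by linarith) k W hv ?_
  rw [div_lt_iff₀ hz] at hk
  linarith
end
end

section
/- Let α = 2√7 − 4. For every ε > 0 and every balanced tetrahedral erasure channel W with 0 < H(W) < 1 and Q(W) > 0, there exists an integer m > 0 such that for every n ≥ m and every string c ∈ {s,p}^n, the descendant W^c satisfies Q(W^c) ≥ α − ε. -/
noncomputable section

open TECQuint

/-- One-step estimate below the attractor. -/
lemma core_low (h x : ℝ) (hh : 0 < h) (h1 : h < 1) :
    h * (12 - 8 * x - x ^ 2) / 12 ≤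
      2 * (1 - x * h / 3) - (1 - x ^ 2 * h ^ 2 / 12) * (2 - h + (1 - h) ^ 2 * x ^ 2 * h / 12) := by
  have key : 2 * (1 - x * h / 3)
      - (1 - x ^ 2 * h ^ 2 / 12) * (2 - h + (1 - h) ^ 2 * x ^ 2 * h / 12)
      - h * (12 - 8 * x - x ^ 2) / 12
      = x ^ 2 * h ^ 2 / 12 * (2 * (2 - h)) + (x ^ 2 * h ^ 2 / 12) * ((1 - h) ^ 2 * x ^ 2 * h / 12) := by
    ring
  have : 0 ≤ x ^ 2 * h ^ 2 / 12 * (2 * (2 - h)) :=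
    mul_nonneg (by positivity) (by linarith)
  have : 0 ≤ (x ^ 2 * h ^ 2 / 12) * ((1 - h) ^ 2 * x ^ 2 * h / 12) := by positivity
  linarith

/-- One-step estimate above the attractor. -/
lemma core_high (h x α : ℝ) (hh : 0 < h) (h1 : h < 1) (hα0 : 0 < α) (hα1 : α ≤ 13 / 10)
    (hα : α ^ 2 + 8 * α = 12) (hx : α ≤ x) (hxh : x * h ≤ 2) :
    α * ((1 - x ^ 2 * h ^ 2 / 12) * (2 - h + (1 - h) ^ 2 * x ^ 2 * h / 12))
      ≤ x * (2 * (1 - x * h / 3)) := by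
  obtain ⟨k, hk⟩ : ∃ k, k = 2 / 3 + α / 12 * (1 - 4 * h + 2 * h ^ 2) := ⟨_, rfl⟩
  have key : x * (2 * (1 - x * h / 3))
      - α * ((1 - x ^ 2 * h ^ 2 / 12) * (2 - h + (1 - h) ^ 2 * x ^ 2 * h / 12))
      = (2 * (x - α) + h * α - h * k * x ^ 2)
        + α * ((x ^ 2 * h ^ 2 / 12) * ((1 - h) ^ 2 * x ^ 2 * h / 12)) := by
    rw [hk]; ring
  have t1 : 0 ≤ α * ((x ^ 2 * h ^ 2 / 12) * ((1 - h) ^ 2 * x ^ 2 * h / 12)) := by positivity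
  have e1 : 2 * (x - α) + h * α - h * k * x ^ 2
      = h * α * (1 - k * α) + (x - α) * (2 - k * (h * x + h * α)) := by ring
  have e2 : 1 - k * α = α ^ 2 / 12 * (2 * h * (2 - h)) := by
    rw [hk]; linear_combination (-1 / 12) * hα
  have t2 : 0 ≤ h * α * (1 - k * α) := by
    rw [e2]
    have : 0 < 2 - h := by linarith
    positivity
  have hk0 : 0 ≤ k := by
    rw [hk]
    nlinarith [mul_nonneg hα0.le (sq_nonneg (1 - h))]
  have t3 : k * (h * x + h * α) ≤ 2 := by
    have a1 : h * x + h * α ≤ 2 + 13 / 10 * h := by nlinarith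
    have a2 : k * (h * x + h * α) ≤ k * (2 + 13 / 10 * h) := mul_le_mul_of_nonneg_left a1 hk0
    have a3 : k ≤ 2 / 3 + α / 12 * (1 - 2 * h) := by
      rw [hk]; nlinarith [mul_pos hα0 (mul_pos hh (sub_pos.2 h1))]
    have a4 : k ≤ 2 / 3 + 13 / 120 * (1 - h) := by
      nlinarith [mul_pos hα0 hh, mul_nonneg (sub_nonneg.2 hα1) (sub_pos.2 h1).le]
    have a5 : k * (2 + 13 / 10 * h) ≤ (2 / 3 + α / 12 * (1 - 2 * h)) * (2 + 13 / 10 * h) :=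
      mul_le_mul_of_nonneg_right a3 (by linarith)
    have hα2 : 129 / 100 ≤ α := by nlinarith
    nlinarith [mul_pos hh (sub_pos.2 h1), mul_nonneg (sub_nonneg.2 hα1) hh.le,
      mul_nonneg (sub_nonneg.2 hα2) hh.le, mul_nonneg (sub_nonneg.2 hα2) (sq_nonneg h), sq_nonneg (h - 3/4)]
  have t4 : 0 ≤ (x - α) * (2 - k * (h * x + h * α)) :=
    mul_nonneg (by linarith) (by linarith)
  linarith

/-- Upper bound on the denominator. -/
lemma core_D (h x : ℝ) (hh : 0 < h) (h1 : h < 1) (hx0 : 0 < x) (hx : x ≤ 3) :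
    (1 - x ^ 2 * h ^ 2 / 12) * (2 - h + (1 - h) ^ 2 * x ^ 2 * h / 12) ≤ 2 := by
  have u1 : 0 ≤ x ^ 2 * h ^ 2 / 12 := by positivity
  have v1 : (1 - h) ^ 2 ≤ 1 := by nlinarith
  have v2 : x ^ 2 ≤ 12 := by nlinarith
  have v3 : (1 - h) ^ 2 * x ^ 2 ≤ 1 * 12 := mul_le_mul v1 v2 (by positivity) (by norm_num)
  have u2 : (1 - h) ^ 2 * x ^ 2 * h ≤ 1 * 12 * h := mul_le_mul_of_nonneg_right v3 hh.le
  have u3 : 0 ≤ (1 - h) ^ 2 * x ^ 2 * h / 12 := by positivity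
  have u4 := mul_nonneg u1 (show 0 ≤ 2 - h + (1 - h) ^ 2 * x ^ 2 * h / 12 by linarith)
  linarith

/-- The quadratic governing growth is antitone on the positive axis. -/
lemma quad_anti (x y : ℝ) (hx : 0 < x) (hxy : x ≤ y) :
    12 - 8 * y - y ^ 2 ≤ 12 - 8 * x - x ^ 2 := by
  nlinarith

/-- One serial step in the coordinates `(h, e)`. -/
lemma core_step (α a b h e : ℝ) (hα0 : 0 < α) (hα1 : α ≤ 13 / 10)
    (hα : α ^ 2 + 8 * α = 12) (ha0 : 0 < a) (ha : a < α) (hb : 0 < b)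
    (hh : 0 < h) (h1 : h < 1) (heg : e ≤ 2 * (1 - h))
    (hbx : b ≤ e / (h * (1 - h))) :
    min a (b * (1 + (12 - 8 * a - a ^ 2) / 24 * h)) ≤
      (2 * (1 - h) * e - 2 * e ^ 2 / 3) /
        ((1 - ((1 - h) ^ 2 - e ^ 2 / 12)) * ((1 - h) ^ 2 - e ^ 2 / 12)) := by
  have hg : 0 < 1 - h := by linarith
  obtain ⟨x, hxd⟩ : ∃ x, x = e / (h * (1 - h)) := ⟨_, rfl⟩
  rw [← hxd] at hbx
  have he : e = x * h * (1 - h) := by rw [hxd]; field_simp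
  have hx0 : 0 < x := by linarith
  have hxh : x * h ≤ 2 := by
    rw [he] at heg
    exact le_of_mul_le_mul_right heg hg
  have hxh0 : 0 < x * h := by positivity
  obtain ⟨D, hD⟩ : ∃ D, D = (1 - x ^ 2 * h ^ 2 / 12) * (2 - h + (1 - h) ^ 2 * x ^ 2 * h / 12) :=
    ⟨_, rfl⟩
  have hD0 : 0 < D := by
    rw [hD]
    apply mul_pos
    · nlinarith
    · have : 0 ≤ (1 - h) ^ 2 * x ^ 2 * h / 12 := by positivity
      linarith
  have hQ : (2 * (1 - h) * e - 2 * e ^ 2 / 3) /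
        ((1 - ((1 - h) ^ 2 - e ^ 2 / 12)) * ((1 - h) ^ 2 - e ^ 2 / 12))
        = x * (2 * (1 - x * h / 3)) / D := by
    have n1 : 2 * (1 - h) * e - 2 * e ^ 2 / 3
        = (h * (1 - h) ^ 2) * (x * (2 * (1 - x * h / 3))) := by rw [he]; ring
    have n2 : (1 - ((1 - h) ^ 2 - e ^ 2 / 12)) * ((1 - h) ^ 2 - e ^ 2 / 12)
        = (h * (1 - h) ^ 2) * D := by rw [he, hD]; ring
    rw [n1, n2, mul_div_mul_left]
    positivity
  rw [hQ, le_div_iff₀ hD0]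
  rcases le_total x α with hxα | hxα
  · have low := core_low h x hh h1
    rw [← hD] at low
    have hD2 : D ≤ 2 := by
      rw [hD]
      exact core_D h x hh h1 hx0 (by linarith)
    have hκ : 0 ≤ 12 - 8 * x - x ^ 2 := by
      have := quad_anti x α hx0 hxα
      linarith
    rcases le_total x a with hxa | hxa
    · have m1 : (12 - 8 * a - a ^ 2) / 24 ≤ (12 - 8 * x - x ^ 2) / 24 := by
        have := quad_anti x a hx0 hxa
        linarith
      have hκa : 0 ≤ (12 - 8 * a - a ^ 2) / 24 := by
        have := quad_anti a α ha0 ha.le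
        linarith
      have m2 : (1 + (12 - 8 * a - a ^ 2) / 24 * h) * D ≤ 2 * (1 - x * h / 3) := by
        have w1 : (12 - 8 * a - a ^ 2) / 24 * h ≤ (12 - 8 * x - x ^ 2) / 24 * h :=
          mul_le_mul_of_nonneg_right m1 hh.le
        have w0 : 0 ≤ (12 - 8 * a - a ^ 2) / 24 * h := mul_nonneg hκa hh.le
        have w2 : (12 - 8 * a - a ^ 2) / 24 * h * D ≤ (12 - 8 * a - a ^ 2) / 24 * h * 2 :=
          mul_le_mul_of_nonneg_left hD2 w0
        have w3 : (1 + (12 - 8 * a - a ^ 2) / 24 * h) * D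
          = D + (12 - 8 * a - a ^ 2) / 24 * h * D := by ring
        have w4 : (12 - 8 * x - x ^ 2) / 24 * h * 2 = h * (12 - 8 * x - x ^ 2) / 12 := by ring
        linarith
      calc min a (b * (1 + (12 - 8 * a - a ^ 2) / 24 * h)) * D
          ≤ (b * (1 + (12 - 8 * a - a ^ 2) / 24 * h)) * D :=
            mul_le_mul_of_nonneg_right (min_le_right _ _) hD0.le
        _ = b * ((1 + (12 - 8 * a - a ^ 2) / 24 * h) * D) := by ring
        _ ≤ x * ((1 + (12 - 8 * a - a ^ 2) / 24 * h) * D) :=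
            mul_le_mul_of_nonneg_right hbx
              (mul_nonneg (by linarith [mul_nonneg hκa hh.le]) hD0.le)
        _ ≤ _ := mul_le_mul_of_nonneg_left m2 hx0.le
    · calc _ ≤ a * D := mul_le_mul_of_nonneg_right (min_le_left _ _) hD0.le
        _ ≤ x * D := mul_le_mul_of_nonneg_right hxa hD0.le
        _ ≤ _ := mul_le_mul_of_nonneg_left (by linarith [mul_nonneg hh.le hκ]) hx0.le
  · have high := core_high h x α hh h1 hα0 hα1 hα hxα hxh
    rw [← hD] at high
    calc _ ≤ a * D := mul_le_mul_of_nonneg_right (min_le_left _ _) hD0.le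
        _ ≤ α * D := mul_le_mul_of_nonneg_right ha.le hD0.le
        _ ≤ _ := high

/-- Bounds on the new entropy after a serial step. -/
lemma core_range (h e : ℝ) (hh : 0 < h) (h1 : h < 1) (he0 : 0 ≤ e) (heg : e ≤ 2 * (1 - h))  :
    h ≤ 1 - ((1 - h) ^ 2 - e ^ 2 / 12) ∧ 2 / 3 * (1 - h) ^ 2 ≤ (1 - h) ^ 2 - e ^ 2 / 12 := by
  constructor <;> nlinarith

/-- Valid states of the balanced process. -/
def Valid (W : TECQuint) : Prop :=
  W.IsTEC ∧ W.Balanced ∧ 0 < entropy W ∧ entropy W < 1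

lemma ser_entropy (W : TECQuint) (hW : W.IsTEC) (hb : W.Balanced) :
    entropy (ser W) = 1 - ((1 - entropy W) ^ 2 - edgeMass W ^ 2 / 12) := by
  obtain ⟨p, q, r, s, t⟩ := W
  obtain ⟨_, _, _, _, _, h⟩ := hW
  obtain ⟨b1, b2⟩ := hb
  simp only at b1 b2 h
  subst b1; subst b2
  simp only [entropy, ser, edgeMass]
  obtain rfl : p = 1 - 3 * q - t := by linarith
  ring

lemma par_entropy (W : TECQuint) (hb : W.Balanced) :
    entropy (par W) = entropy W ^ 2 - edgeMass W ^ 2 / 12 := by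
  obtain ⟨p, q, r, s, t⟩ := W
  obtain ⟨b1, b2⟩ := hb
  simp only at b1 b2
  subst b1; subst b2
  simp only [entropy, par, edgeMass]
  ring

lemma ser_edge (W : TECQuint) (hW : W.IsTEC) (hb : W.Balanced) :
    edgeMass (ser W) = 2 * (1 - entropy W) * edgeMass W - 2 * edgeMass W ^ 2 / 3 := by
  obtain ⟨p, q, r, s, t⟩ := W
  obtain ⟨_, _, _, _, _, h⟩ := hW
  obtain ⟨b1, b2⟩ := hb
  simp only at b1 b2 h
  subst b1; subst b2
  simp only [entropy, ser, edgeMass]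
  obtain rfl : p = 1 - 3 * q - t := by linarith
  ring

lemma par_edge (W : TECQuint) (hb : W.Balanced) :
    edgeMass (par W) = 2 * entropy W * edgeMass W - 2 * edgeMass W ^ 2 / 3 := by
  obtain ⟨p, q, r, s, t⟩ := W
  obtain ⟨b1, b2⟩ := hb
  simp only at b1 b2
  subst b1; subst b2
  simp only [entropy, par, edgeMass]
  ring

lemma child_tec (W : TECQuint) (hW : W.IsTEC) (hb : W.Balanced) (c : Bool) :
    (child W c).IsTEC ∧ (child W c).Balanced := by
  obtain ⟨p, q, r, s, t⟩ := W
  obtain ⟨hp, hq, hr, hs, ht, h⟩ := hW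
  obtain ⟨b1, b2⟩ := hb
  simp only at b1 b2 h hp hq hr hs ht
  subst b1; subst b2
  cases c
  · rw [show child _ false = par _ from rfl]
    simp only [par, IsTEC, TECQuint.Balanced]
    refine ⟨⟨?_, by positivity, by positivity, by positivity, by positivity, by ring⟩,
      by simp⟩
    obtain rfl : p = 1 - 3 * q - t := by linarith
    nlinarith [mul_nonneg hq ht, mul_nonneg hq hp, mul_nonneg ht hp, mul_nonneg hp hp, mul_nonneg hq hq]
  · rw [show child _ true = ser _ from rfl]
    simp only [ser, IsTEC, TECQuint.Balanced]
    refine ⟨⟨by positivity, by positivity, by positivity, by positivity, ?_, by ring⟩,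
      by simp⟩
    obtain rfl : t = 1 - 3 * q - p := by linarith
    nlinarith [mul_nonneg hq ht, mul_nonneg hq hp, mul_nonneg ht hp, mul_nonneg ht ht, mul_nonneg hq hq]

lemma edge_bounds (W : TECQuint) (hW : W.IsTEC) :
    0 ≤ edgeMass W ∧ edgeMass W ≤ 2 * (1 - entropy W) ∧ edgeMass W ≤ 2 * entropy W := by
  obtain ⟨hp, hq, hr, hs, ht, h⟩ := hW
  simp only [edgeMass, entropy]
  refine ⟨?_, ?_, ?_⟩ <;> linarith

lemma valid_child (W : TECQuint) (hV : Valid W) (c : Bool) : Valid (child W c) := by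
  obtain ⟨hW, hb, h0, h1⟩ := hV
  obtain ⟨e0, e1, e2⟩ := edge_bounds W hW
  obtain ⟨hT, hB⟩ := child_tec W hW hb c
  refine ⟨hT, hB, ?_⟩
  cases c
  · have := core_range (1 - entropy W) (edgeMass W) (by linarith) (by linarith) e0 (by linarith)
    rw [show child W false = par W from rfl, par_entropy W hb]
    have : 0 < entropy W ^ 2 := by positivity
    constructor <;> nlinarith
  · have := core_range (entropy W) (edgeMass W) (by linarith) (by linarith) e0 (by linarith)
    rw [show child W true = ser W from rfl, ser_entropy W hW hb]
    have : 0 < (1 - entropy W) ^ 2 := by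
      have : 0 < 1 - entropy W := by linarith
      positivity
    constructor <;> nlinarith

/-- The step lemma for both kinds of child. -/
lemma step (α a b δ : ℝ) (hα0 : 0 < α) (hα1 : α ≤ 13 / 10)
    (hα : α ^ 2 + 8 * α = 12) (ha0 : 0 < a) (ha : a < α) (hb : 0 < b)
    (hδ : 0 < δ) (hδ6 : δ ≤ 1 / 6)
    (W : TECQuint) (hV : Valid W) (hl : δ ≤ entropy W) (hu : δ ≤ 1 - entropy W)
    (hQ : b ≤ quetelet W) (c : Bool) :
    (δ ≤ entropy (child W c) ∧ δ ≤ 1 - entropy (child W c) ∧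
      min a (b * (1 + (12 - 8 * a - a ^ 2) / 24 * δ)) ≤ quetelet (child W c)) ∨
    (2 / 3 * δ ^ 2 ≤ entropy (child W c) ∧ 2 / 3 * δ ^ 2 ≤ 1 - entropy (child W c) ∧
      min a (b * (1 + (12 - 8 * a - a ^ 2) / 24 * (1 / 2))) ≤ quetelet (child W c)) := by
  obtain ⟨hW, hbal, h0, h1⟩ := hV
  obtain ⟨e0, e1, e2⟩ := edge_bounds W hW
  have hκa : 0 ≤ (12 - 8 * a - a ^ 2) / 24 := by nlinarith
  have mono : ∀ y z : ℝ, y ≤ z → min a (b * (1 + (12 - 8 * a - a ^ 2) / 24 * y)) ≤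
      min a (b * (1 + (12 - 8 * a - a ^ 2) / 24 * z)) := by
    intro y z hyz
    gcongr
  unfold quetelet at hQ
  -- a uniform statement in terms of the coordinate `h`
  have main : ∀ h e : ℝ, δ ≤ h → δ ≤ 1 - h → 0 ≤ e → e ≤ 2 * (1 - h) →
      b ≤ e / (h * (1 - h)) → 
      (δ ≤ 1 - ((1 - h) ^ 2 - e ^ 2 / 12) ∧ δ ≤ (1 - h) ^ 2 - e ^ 2 / 12 ∧
      min a (b * (1 + (12 - 8 * a - a ^ 2) / 24 * δ)) ≤ (2 * (1 - h) * e - 2 * e ^ 2 / 3) /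
        ((1 - ((1 - h) ^ 2 - e ^ 2 / 12)) * ((1 - h) ^ 2 - e ^ 2 / 12))) ∨
      (2 / 3 * δ ^ 2 ≤ 1 - ((1 - h) ^ 2 - e ^ 2 / 12) ∧
        2 / 3 * δ ^ 2 ≤ (1 - h) ^ 2 - e ^ 2 / 12 ∧
      min a (b * (1 + (12 - 8 * a - a ^ 2) / 24 * (1 / 2))) ≤
        (2 * (1 - h) * e - 2 * e ^ 2 / 3) /
        ((1 - ((1 - h) ^ 2 - e ^ 2 / 12)) * ((1 - h) ^ 2 - e ^ 2 / 12))) := by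
    intro h e hl hu he0 heg hbx
    have st := core_step α a b h e hα0 hα1 hα ha0 ha hb (by linarith) (by linarith) heg hbx
    obtain ⟨r1, r2⟩ := core_range h e (by linarith) (by linarith) he0 heg
    rcases le_total h (1 / 2) with hh | hh
    · left
      exact ⟨by linarith, by nlinarith, (mono _ _ hl).trans st⟩
    · right
      exact ⟨by nlinarith, by nlinarith, (mono _ _ hh).trans st⟩
  cases c
  · rw [show child W false = par W from rfl]
    unfold quetelet
    rw [par_entropy W hbal, par_edge W hbal]
    have := main (1 - entropy W) (edgeMass W) hu (by linarith) e0 (by linarith)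
      (by rw [sub_sub_cancel, mul_comm]; exact hQ)
    rw [sub_sub_cancel, mul_comm (1 - (entropy W ^ 2 - edgeMass W ^ 2 / 12))] at this
    tauto
  · rw [show child W true = ser W from rfl]
    unfold quetelet
    rw [ser_entropy W hW hbal, ser_edge W hW hbal]
    have := main (entropy W) (edgeMass W) hl (by linarith) e0 (by linarith) hQ
    rw [sub_sub_cancel]
    exact this

/-- Uniform eventual attraction from Quetelet index at least `b`. -/
def Attr (a b δ : ℝ) : Prop :=
  ∃ m : ℕ, ∀ W : TECQuint, Valid W → δ ≤ entropy W → δ ≤ 1 - entropy W → b ≤ quetelet W →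
    ∀ n : ℕ, m ≤ n → ∀ c : Fin n → Bool, a ≤ quetelet (descend W c)

lemma invariance (α a : ℝ) (hα0 : 0 < α) (hα1 : α ≤ 13 / 10)
    (hα : α ^ 2 + 8 * α = 12) (ha0 : 0 < a) (ha : a < α) :
    ∀ n : ℕ, ∀ W : TECQuint, Valid W → a ≤ quetelet W → ∀ c : Fin n → Bool,
      a ≤ quetelet (descend W c) := by
  intro n
  induction n with
  | zero => intro W _ hQ c; exact hQ
  | succ n ih =>
    intro W hV hQ c
    refine ih (child W (c 0)) (valid_child W hV _) ?_ _
    have hκa : 0 ≤ (12 - 8 * a - a ^ 2) / 24 := by nlinarith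
    obtain ⟨δ, hδ0, hδ1, hδ2, hδ3⟩ : ∃ δ : ℝ, 0 < δ ∧ δ ≤ 1 / 6 ∧ δ ≤ entropy W ∧
        δ ≤ 1 - entropy W := by
      refine ⟨min (1 / 6) (min (entropy W) (1 - entropy W)), ?_, min_le_left _ _,
        (min_le_right _ _).trans (min_le_left _ _), (min_le_right _ _).trans (min_le_right _ _)⟩
      have := hV.2.2.1
      have := hV.2.2.2
      refine lt_min (by norm_num) (lt_min (by linarith) (by linarith))
    have aux : ∀ y : ℝ, 0 ≤ y → a ≤ min a (a * (1 + (12 - 8 * a - a ^ 2) / 24 * y)) := by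
      intro y hy
      refine le_min le_rfl ?_
      have := mul_nonneg ha0.le (mul_nonneg hκa hy)
      linarith
    rcases step α a a δ hα0 hα1 hα ha0 ha ha0 hδ0 hδ1 W hV hδ2 hδ3 hQ (c 0) with h | h
    · exact (aux _ hδ0.le).trans h.2.2
    · exact (aux _ (by norm_num)).trans h.2.2

lemma attr_all (α a : ℝ) (hα0 : 0 < α) (hα1 : α ≤ 13 / 10)
    (hα : α ^ 2 + 8 * α = 12) (ha0 : 0 < a) (ha : a < α) :
    ∀ N : ℕ, ∀ b : ℝ, 0 < b → a ≤ b * (1 + (12 - 8 * a - a ^ 2) / 24 * (1 / 2)) ^ N →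
      ∀ δ : ℝ, 0 < δ → Attr a b δ := by
  have inv := invariance α a hα0 hα1 hα ha0 ha
  have hκa : 0 < (12 - 8 * a - a ^ 2) / 24 := by nlinarith
  intro N
  induction N with
  | zero =>
    intro b hb hab δ hδ
    refine ⟨0, fun W hV _ _ hQ n _ c => inv n W hV ?_ c⟩
    simp at hab
    linarith
  | succ N ih =>
    intro b hb hab
    -- it suffices to treat small δ
    suffices H : ∀ δ : ℝ, 0 < δ → δ ≤ 1 / 6 → Attr a b δ by
      intro δ hδ
      obtain ⟨m, hm⟩ := H (min δ (1 / 6)) (lt_min hδ (by norm_num)) (min_le_right _ _)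
      exact ⟨m, fun W hV hl hu => hm W hV ((min_le_left _ _).trans hl) ((min_le_left _ _).trans hu)⟩
    intro δ hδ hδ6
    set κ := (12 - 8 * a - a ^ 2) / 24 with hκ
    have next : ∀ δ : ℝ, 0 < δ → Attr a (b * (1 + κ * (1 / 2))) δ := by
      apply ih
      · positivity
      · rw [pow_succ'] at hab
        linarith
    have inner : ∀ M : ℕ, ∀ b' : ℝ, b ≤ b' → b * (1 + κ * (1 / 2)) ≤ b' * (1 + κ * δ) ^ M →
        Attr a b' δ := by
      intro M
      induction M with
      | zero =>
        intro b' _ hb'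
        obtain ⟨m, hm⟩ := next δ hδ
        refine ⟨m, fun W hV hl hu hQ => hm W hV hl hu ?_⟩
        simp at hb' ⊢
        linarith
      | succ M ihM =>
        intro b' hbb' hb'
        have hb'0 : 0 < b' := by linarith
        obtain ⟨m1, hm1⟩ := ihM (b' * (1 + κ * δ))
          (by have := mul_pos hb'0 (mul_pos hκa hδ); linarith)
          (by rw [pow_succ'] at hb'; linarith)
        obtain ⟨m2, hm2⟩ := next (2 / 3 * δ ^ 2) (by positivity)
        refine ⟨max m1 m2 + 1, fun W hV hl hu hQ n hn c => ?_⟩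
        obtain _ | n := n
        · omega
        have hV' := valid_child W hV (c 0)
        by_cases hQa : a ≤ quetelet (child W (c 0))
        · exact inv n (child W (c 0)) hV' hQa _
        rcases step α a b' δ hα0 hα1 hα ha0 ha hb'0 hδ hδ6 W hV hl hu hQ (c 0) with h | h
        · refine hm1 (child W (c 0)) hV' h.1 h.2.1 ?_ n (by omega) _
          rcases min_le_iff.1 h.2.2 with h' | h'
          · exact absurd h' hQa
          · exact h'
        · refine hm2 (child W (c 0)) hV' h.1 h.2.1 ?_ n (by omega) _
          rcases min_le_iff.1 h.2.2 with h' | h'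
          · exact absurd h' hQa
          · refine le_trans ?_ h'
            gcongr
    obtain ⟨M, hM⟩ := pow_unbounded_of_one_lt (1 + κ * (1 / 2))
      (show 1 < 1 + κ * δ by have := mul_pos hκa hδ; linarith)
    exact inner M b le_rfl (mul_le_mul_of_nonneg_left hM.le hb.le)

theorem ultimate_attraction (ε : ℝ) (hε : 0 < ε)
    (W : TECQuint) (hW : W.IsTEC) (hbal : W.Balanced)
    (h0 : 0 < entropy W) (h1 : entropy W < 1)
    (hQ : 0 < quetelet W) :
    ∃ m : ℕ, 0 < m ∧ ∀ n : ℕ, m ≤ n → ∀ c : Fin n → Bool,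
      (2 * Real.sqrt 7 - 4) - ε ≤ quetelet (descend W c) := by
  have hs : Real.sqrt 7 ^ 2 = 7 := Real.sq_sqrt (by norm_num)
  have hs0 : 0 ≤ Real.sqrt 7 := Real.sqrt_nonneg 7
  have hlo : (5 / 2 : ℝ) < Real.sqrt 7 := by nlinarith
  have hhi : Real.sqrt 7 ≤ 265 / 100 := by nlinarith
  obtain ⟨α, hαd⟩ : ∃ α, α = 2 * Real.sqrt 7 - 4 := ⟨_, rfl⟩
  rw [← hαd]
  have hα : α ^ 2 + 8 * α = 12 := by rw [hαd]; nlinarith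
  obtain ⟨a, had⟩ : ∃ a, a = α - min ε (1 / 2) := ⟨_, rfl⟩
  have e1 : min ε (1 / 2) ≤ ε := min_le_left _ _
  have e2 : min ε (1 / 2) ≤ 1 / 2 := min_le_right _ _
  have e3 : 0 < min ε (1 / 2) := lt_min hε (by norm_num)
  have ha0 : 0 < a := by linarith
  have ha : a < α := by linarith
  have hκa : 0 < (12 - 8 * a - a ^ 2) / 24 := by nlinarith
  obtain ⟨N, hN⟩ := pow_unbounded_of_one_lt (a / quetelet W)
    (show 1 < 1 + (12 - 8 * a - a ^ 2) / 24 * (1 / 2) by linarith)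
  have hN' := (div_lt_iff₀' hQ).1 hN
  obtain ⟨m, hm⟩ := attr_all α a (by linarith) (by linarith) hα ha0 ha N (quetelet W) hQ hN'.le
    (min (entropy W) (1 - entropy W)) (lt_min h0 (by linarith))
  refine ⟨m + 1, by omega, fun n hn c => ?_⟩
  have := hm W ⟨hW, hbal, h0, h1⟩ (min_le_left _ _) (min_le_right _ _) le_rfl n (by omega) c
  linarith
end
end

section
/- Define ψ(x) = (x(1−x))^{0.697}·(5 − √(x(1−x))) for 0 < x < 1. Then for every x with 0 < x < 1, ψ((169x² + 54x³ − 27x⁴)/196) + ψ((392x − 169x² − 54x³ + 27x⁴)/196) < 2·0.818·ψ(x). -/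
noncomputable section

open TECQuint

/-- The eigenfunction `ψ(x) = (x(1−x))^0.697 · (5 − √(x(1−x)))`. -/
noncomputable def psi (x : ℝ) : ℝ :=
  (x * (1 - x)) ^ (0.697 : ℝ) * (5 - Real.sqrt (x * (1 - x)))

/-! ### Polynomials with rational coefficients, as lists -/

/-- Evaluation of a coefficient list at a real point. -/
def pev : List ℚ → ℝ → ℝ
  | [], _ => 0
  | a :: p, x => (a : ℝ) + x * pev p x

def padd : List ℚ → List ℚ → List ℚ
  | [], q => q
  | a :: p, [] => a :: p
  | a :: p, b :: q => (a + b) :: padd p q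

def psc (k : ℚ) : List ℚ → List ℚ
  | [] => []
  | a :: p => (k * a) :: psc k p

def pmul : List ℚ → List ℚ → List ℚ
  | [], _ => []
  | a :: p, q => padd (psc a q) (0 :: pmul p q)

/-- Substitution `x ↦ l + d x`. -/
def pcomp (l d : ℚ) : List ℚ → List ℚ
  | [] => []
  | a :: p => padd [a] (pmul [l, d] (pcomp l d p))

/-- Scale by `10 ^ 10` and round down to integers. -/
def pfloor : List ℚ → List ℤ
  | [] => []
  | a :: p => ⌊a * 10 ^ 10⌋ :: pfloor p

def iev : List ℤ → ℝ → ℝ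
  | [], _ => 0
  | a :: p, x => (a : ℝ) + x * iev p x

def iadd : List ℤ → List ℤ → List ℤ
  | [], q => q
  | a :: p, [] => a :: p
  | a :: p, b :: q => (a + b) :: iadd p q

/-- Möbius transform `s = 1 / (1 + t)`, by Horner's scheme. -/
def imob : List ℤ → List ℤ → List ℤ
  | acc, [] => acc
  | acc, a :: p => imob (iadd [a] (iadd acc (0 :: acc))) p

def allNonneg : List ℤ → Bool
  | [] => true
  | a :: p => decide (0 ≤ a) && allNonneg p

/-- Sufficient check for nonnegativity on `(0, 1]`. -/
def pchk (p : List ℚ) : Bool := allNonneg (imob [] (pfloor p))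

lemma pev_padd (p q : List ℚ) (x : ℝ) : pev (padd p q) x = pev p x + pev q x := by
  induction p generalizing q with
  | nil => simp [padd, pev]
  | cons a p ih =>
    cases q with
    | nil => simp [padd, pev]
    | cons b q => simp only [padd, pev, ih]; push_cast; ring

lemma pev_psc (k : ℚ) (p : List ℚ) (x : ℝ) : pev (psc k p) x = k * pev p x := by
  induction p with
  | nil => simp [psc, pev]
  | cons a p ih => simp only [psc, pev, ih]; push_cast; ring

lemma pev_pmul (p q : List ℚ) (x : ℝ) : pev (pmul p q) x = pev p x * pev q x := by
  induction p with
  | nil => simp [pmul, pev]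
  | cons a p ih => simp only [pmul, pev, ih, pev_padd, pev_psc]; push_cast; ring

lemma pev_pcomp (l d : ℚ) (p : List ℚ) (x : ℝ) : pev (pcomp l d p) x = pev p (l + d * x) := by
  induction p with
  | nil => simp [pcomp, pev]
  | cons a p ih => simp only [pcomp, pev, ih, pev_padd, pev_pmul]; ring

lemma iev_iadd (p q : List ℤ) (x : ℝ) : iev (iadd p q) x = iev p x + iev q x := by
  induction p generalizing q with
  | nil => simp [iadd, iev]
  | cons a p ih =>
    cases q with
    | nil => simp [iadd, iev]
    | cons b q => simp only [iadd, iev, ih]; push_cast; ring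

lemma iev_pfloor (p : List ℚ) (x : ℝ) (hx : 0 ≤ x) : iev (pfloor p) x ≤ 10 ^ 10 * pev p x := by
  induction p with
  | nil => simp [pfloor, iev, pev]
  | cons a p ih =>
    simp only [pfloor, iev, pev]
    have h1 : ((⌊a * 10 ^ 10⌋ : ℤ) : ℝ) ≤ a * 10 ^ 10 := by
      have := Int.floor_le (a * 10 ^ 10)
      exact_mod_cast this
    have h2 := mul_le_mul_of_nonneg_left ih hx
    linarith

lemma iev_imob (acc p : List ℤ) (t : ℝ) (ht : 0 ≤ t) :
    iev (imob acc p) t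
      = (1 + t) ^ p.length * (iev acc t + 1 / (1 + t) * iev p (1 / (1 + t))) := by
  have h1 : (1 + t) ≠ 0 := by positivity
  induction p generalizing acc with
  | nil => simp [imob, iev]
  | cons a p ih =>
    simp only [imob, iev, ih, iev_iadd, List.length_cons, pow_succ]
    generalize iev p (1 / (1 + t)) = r
    push_cast
    field_simp
    ring

lemma iev_nonneg (p : List ℤ) (h : allNonneg p = true) (t : ℝ) (ht : 0 ≤ t) : 0 ≤ iev p t := by
  induction p with
  | nil => simp [iev]
  | cons a p ih =>
    simp only [allNonneg, Bool.and_eq_true, decide_eq_true_eq] at h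
    have h1 : (0 : ℝ) ≤ a := by exact_mod_cast h.1
    have h2 := ih h.2
    simp only [iev]
    positivity

lemma pchk_sound (p : List ℚ) (hc : pchk p = true) (s : ℝ)
    (hl : 0 < s) (hh : s ≤ 1) : 0 ≤ pev p s := by
  have ht0 : 0 ≤ 1 / s - 1 := by
    rw [sub_nonneg, le_div_iff₀ hl]; linarith
  have h4 : 1 / (1 + (1 / s - 1)) = s := by rw [add_sub_cancel, one_div_one_div]
  have h2 := iev_imob [] (pfloor p) _ ht0
  have h3 := iev_nonneg _ hc _ ht0
  have h7 := iev_pfloor p s hl.le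
  rw [h2, h4] at h3
  have h5 : 0 < (1 + (1 / s - 1)) ^ (pfloor p).length := by positivity
  have h6 := nonneg_of_mul_nonneg_right h3 h5
  simp only [iev, zero_add] at h6
  have h8 := nonneg_of_mul_nonneg_right h6 hl
  linarith

/-! ### Cubic Taylor bounds for powers -/

def cubic (al z : ℝ) : ℝ :=
  1 + z * (al + z * (al * (al - 1) / 2 + al * (al - 1) * (al - 2) / 6 * z))

lemma bern_neg (g w : ℝ) (hg : g ≤ 0) (hw : 0 < w) : 1 + g * (w - 1) ≤ w ^ g := by
  rw [Real.rpow_def_of_pos hw]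
  have h1 := Real.add_one_le_exp (Real.log w * g)
  have h2 := Real.log_le_sub_one_of_pos hw
  nlinarith

lemma taylor_sign (al s : ℝ) (hal : al ≤ 2) (hs : 0 ≤ s * (al * (al - 1))) (w : ℝ) (hw : 0 < w) :
    0 ≤ s * (w ^ al - cubic al (w - 1)) := by
  set f : ℝ → ℝ := fun w => s * (w ^ al - cubic al (w - 1)) with hf
  set f1 : ℝ → ℝ := fun w => s * (al * w ^ (al - 1) - (al + al * (al - 1) * (w - 1)
    + al * (al - 1) * (al - 2) / 2 * (w - 1) ^ 2)) with hf1
  have d0 : ∀ w : ℝ, 0 < w → HasDerivAt f (f1 w) w := by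
    intro w hw
    have h1 := Real.hasDerivAt_rpow_const (x := w) (p := al) (Or.inl hw.ne')
    have hz := (hasDerivAt_id w).sub_const 1
    have h2 : HasDerivAt (fun w : ℝ => cubic al (w - 1)) (al + al * (al - 1) * (w - 1)
        + al * (al - 1) * (al - 2) / 2 * (w - 1) ^ 2) w := by
      have := (hz.mul (((hz.mul ((hz.const_mul
        (al * (al - 1) * (al - 2) / 6)).const_add (al * (al - 1) / 2)))).const_add al)).const_add 1
      refine HasDerivAt.congr_deriv this ?_
      simp only [id, Pi.mul_apply]
      ring
    exact (h1.sub h2).const_mul s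
  have d1 : ∀ w : ℝ, 0 < w → HasDerivAt f1
      (s * (al * (al - 1)) * (w ^ (al - 2) - (1 + (al - 2) * (w - 1)))) w := by
    intro w hw
    have h1 := (Real.hasDerivAt_rpow_const (x := w) (p := al - 1) (Or.inl hw.ne')).const_mul al
    have hz := (hasDerivAt_id w).sub_const 1
    have h2 := ((hz.const_mul (al * (al - 1))).const_add al).add
      ((hz.pow 2).const_mul (al * (al - 1) * (al - 2) / 2))
    have h3 := (h1.sub h2).const_mul s
    refine HasDerivAt.congr_deriv h3 ?_
    have : al - 1 - 1 = al - 2 := by ring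
    rw [this]
    simp only [id]
    push_cast
    ring
  have mono : MonotoneOn f1 (Set.Ioi 0) := by
    apply monotoneOn_of_deriv_nonneg (convex_Ioi 0)
    · exact fun w hw => (d1 w hw).continuousAt.continuousWithinAt
    · rw [interior_Ioi]
      exact fun w hw => (d1 w hw).differentiableAt.differentiableWithinAt
    · rw [interior_Ioi]
      intro w hw
      rw [(d1 w hw).deriv]
      have := bern_neg (al - 2) w (by linarith) hw
      exact mul_nonneg hs (by linarith)
  have f11 : f1 1 = 0 := by simp [hf1]
  have f01 : f 1 = 0 := by simp [hf, cubic]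
  have hmin : IsMinOn f (Set.Ioi 0) 1 := by
    apply isMinOn_Ioi_of_deriv (d0 1 one_pos).continuousAt
    · exact fun w hw => (d0 w hw.1).differentiableAt.differentiableWithinAt
    · exact fun w hw => (d0 w (lt_trans one_pos hw)).differentiableAt.differentiableWithinAt
    · intro w hw
      rw [(d0 w hw.1).deriv, ← f11]
      exact mono hw.1 (Set.mem_Ioi.2 one_pos) hw.2.le
    · intro w hw
      have hw1 : (1 : ℝ) < w := hw
      rw [(d0 w (by linarith)).deriv, ← f11]
      exact mono (Set.mem_Ioi.2 one_pos) (Set.mem_Ioi.2 (by linarith)) hw1.le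
  have := hmin (Set.mem_Ioi.2 hw)
  simp only [Set.mem_ofPred_eq, f01] at this
  exact this

lemma upper_pow (c K : ℚ) (hc : 0 < c) (hK : 0 < K) (h : c ^ 697 ≤ K ^ 1000) (t : ℝ) (ht : 0 < t) :
    t ^ (0.697 : ℝ) ≤ K * cubic 0.697 (t / c - 1) := by
  have hc' : (0 : ℝ) < c := by exact_mod_cast hc
  have hK' : (0 : ℝ) < K := by exact_mod_cast hK
  have hw : 0 < t / c := by positivity
  have h1 := taylor_sign 0.697 (-1) (by norm_num) (by norm_num) (t / c) hw
  have h2 : (c : ℝ) ^ (0.697 : ℝ) ≤ K := by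
    have h3 : (c : ℝ) ^ (697 : ℕ) ≤ (K : ℝ) ^ (1000 : ℕ) := by exact_mod_cast h
    have h4 : ((c : ℝ) ^ (0.697 : ℝ)) ^ (1000 : ℕ) = (c : ℝ) ^ (697 : ℕ) := by
      rw [← Real.rpow_natCast, ← Real.rpow_mul hc'.le, ← Real.rpow_natCast]
      norm_num
    rw [← h4] at h3
    exact le_of_pow_le_pow_left₀ (by norm_num) hK'.le h3
  have h5 : t ^ (0.697 : ℝ) = (c : ℝ) ^ (0.697 : ℝ) * (t / c) ^ (0.697 : ℝ) := by
    rw [← Real.mul_rpow hc'.le hw.le]; congr 1; field_simp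
  have h6 : 0 ≤ (t / c) ^ (0.697 : ℝ) := by positivity
  rw [h5]
  calc _ ≤ (K : ℝ) * (t / c) ^ (0.697 : ℝ) := mul_le_mul_of_nonneg_right h2 h6
    _ ≤ _ := mul_le_mul_of_nonneg_left (by linarith) hK'.le

lemma lower_pow (c M : ℚ) (hc : 0 < c) (hM : 0 < M) (h : M ^ 1000 ≤ c ^ 1197) (t : ℝ) (ht : 0 < t) :
    M * cubic 1.197 (t / c - 1) ≤ t ^ (1.197 : ℝ) := by
  have hc' : (0 : ℝ) < c := by exact_mod_cast hc
  have hM' : (0 : ℝ) < M := by exact_mod_cast hM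
  have hw : 0 < t / c := by positivity
  have h1 := taylor_sign 1.197 1 (by norm_num) (by norm_num) (t / c) hw
  have h2 : (M : ℝ) ≤ (c : ℝ) ^ (1.197 : ℝ) := by
    have h3 : (M : ℝ) ^ (1000 : ℕ) ≤ (c : ℝ) ^ (1197 : ℕ) := by exact_mod_cast h
    have h4 : ((c : ℝ) ^ (1.197 : ℝ)) ^ (1000 : ℕ) = (c : ℝ) ^ (1197 : ℕ) := by
      rw [← Real.rpow_natCast, ← Real.rpow_mul hc'.le, ← Real.rpow_natCast]
      norm_num
    rw [← h4] at h3
    exact le_of_pow_le_pow_left₀ (by norm_num) (by positivity) h3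
  have h5 : t ^ (1.197 : ℝ) = (c : ℝ) ^ (1.197 : ℝ) * (t / c) ^ (1.197 : ℝ) := by
    rw [← Real.mul_rpow hc'.le hw.le]; congr 1; field_simp
  have h6 : 0 ≤ (t / c) ^ (1.197 : ℝ) := by positivity
  rw [h5]
  calc _ ≤ (M : ℝ) * (t / c) ^ (1.197 : ℝ) := mul_le_mul_of_nonneg_left (by linarith) hM'.le
    _ ≤ _ := mul_le_mul_of_nonneg_right h2 h6

/-! ### The certificate check -/

def polA : List ℚ := psc (1 / 196 ^ 2) (pmul [0, 1] (pmul [169, 54, -27] [196, 196, 27, -27]))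
def polB : List ℚ := psc (1 / 196 ^ 2) (pmul [1, -1] (pmul [392, -169, -54, 27] [196, 0, -27]))
def polX : List ℚ := [0, 1, -1]

def polCubic (al c : ℚ) (p : List ℚ) : List ℚ :=
  let z := padd (psc (1 / c) p) [-1]
  padd [1] (pmul z (padd [al] (pmul z (padd [al * (al - 1) / 2]
    (psc (al * (al - 1) * (al - 2) / 6) z)))))

/-- Data for one interval `(l, h]`: Taylor centres, bounds for their powers, and a polynomial
`lo` with `lo ≤ √(x(1-x)) ≤ lo + e`. -/
structure Cert where
  l : ℚ
  h : ℚ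
  cA : ℚ
  cB : ℚ
  kA : ℚ
  kB : ℚ
  mA : ℚ
  mB : ℚ
  lo : List ℚ
  e : ℚ

/-- Substitution of `l + (h - l) s` for `x`. -/
def Cert.sub (C : Cert) (p : List ℚ) : List ℚ := pcomp C.l (C.h - C.l) p
def Cert.loc (C : Cert) : List ℚ := C.sub C.lo
def Cert.hi (C : Cert) : List ℚ := padd C.loc [C.e]
def Cert.low (C : Cert) : List ℚ :=
  padd (padd (psc C.mA (polCubic (1197 / 1000) C.cA (C.sub polA)))
    (psc C.mB (polCubic (1197 / 1000) C.cB (C.sub polB)))) [-1636 / 1000]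
def Cert.base (C : Cert) : List ℚ :=
  padd [8180 / 1000 - 1 / 1000000] (psc (-5)
    (padd (psc C.kA (polCubic (697 / 1000) C.cA (C.sub polA))) (psc C.kB (polCubic (697 / 1000) C.cB (C.sub polB)))))

def Cert.ok (C : Cert) : Bool :=
  decide (0 < C.cA) && decide (0 < C.cB) && decide (0 < C.kA) && decide (0 < C.kB) &&
  decide (0 < C.mA) && decide (0 < C.mB) &&
  decide (C.cA ^ 697 ≤ C.kA ^ 1000) && decide (C.cB ^ 697 ≤ C.kB ^ 1000) &&
  decide (C.mA ^ 1000 ≤ C.cA ^ 1197) && decide (C.mB ^ 1000 ≤ C.cB ^ 1197) &&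
  pchk (padd (C.sub polX) (psc (-1) (pmul C.loc C.loc))) &&
  pchk (padd (pmul C.hi C.hi) (psc (-1) (C.sub polX))) &&
  pchk C.hi &&
  pchk (padd C.base (pmul C.loc C.low)) &&
  pchk (padd C.base (pmul C.hi C.low))

lemma pev_polCubic (al c : ℚ) (p : List ℚ) (x : ℝ) :
    pev (polCubic al c p) x = cubic al (pev p x / c - 1) := by
  simp only [polCubic, cubic, pev_padd, pev_pmul, pev_psc, pev]
  push_cast
  ring

lemma linear_between (b m u v w : ℝ) (hu : u ≤ v) (hw : v ≤ w) (h1 : 0 ≤ b + u * m)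
    (h2 : 0 ≤ b + w * m) : 0 ≤ b + v * m := by
  rcases le_total 0 m with h | h <;> nlinarith

lemma Cert.sound (C : Cert) (hC : C.ok = true) (x : ℝ) (hl : (C.l : ℝ) < x) (hh : x ≤ C.h)
    (hA : 0 < pev polA x) (hB : 0 < pev polB x) :
    5 * ((pev polA x) ^ (0.697 : ℝ) + (pev polB x) ^ (0.697 : ℝ))
      - √(x * (1 - x)) * ((pev polA x) ^ (1.197 : ℝ) + (pev polB x) ^ (1.197 : ℝ))
      < 2 * 0.818 * (5 - √(x * (1 - x))) := by
  simp only [Cert.ok, Bool.and_eq_true, decide_eq_true_eq] at hC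
  obtain ⟨⟨⟨⟨⟨⟨⟨⟨⟨⟨⟨⟨⟨⟨c1, c2⟩, c3⟩, c4⟩, c5⟩, c6⟩, c7⟩, c8⟩, c9⟩, c10⟩, c11⟩, c12⟩, c13⟩, c14⟩, c15⟩ := hC
  have a1 := upper_pow _ _ c1 c3 c7 _ hA
  have a2 := upper_pow _ _ c2 c4 c8 _ hB
  have a3 := lower_pow _ _ c1 c5 c9 _ hA
  have a4 := lower_pow _ _ c2 c6 c10 _ hB
  have hX : pev polX x = x * (1 - x) := by simp only [polX, pev]; push_cast; ring
  have hd : (0 : ℝ) < (C.h : ℝ) - C.l := by linarith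
  obtain ⟨s, hs⟩ : ∃ s : ℝ, s = (x - C.l) / (C.h - C.l) := ⟨_, rfl⟩
  have hs0 : 0 < s := by rw [hs]; exact div_pos (by linarith) hd
  have hs1 : s ≤ 1 := by rw [hs, div_le_one hd]; linarith
  have hsub : ∀ p, pev (C.sub p) s = pev p x := by
    intro p
    rw [Cert.sub, pev_pcomp]
    have hx : (C.l : ℝ) + ((C.h - C.l : ℚ) : ℝ) * s = x := by
      rw [hs]; push_cast; field_simp; ring
    rw [hx]
  have b1 := pchk_sound _ c11 s hs0 hs1
  have b2 := pchk_sound _ c12 s hs0 hs1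
  have b3 := pchk_sound _ c13 s hs0 hs1
  have b4 := pchk_sound _ c14 s hs0 hs1
  have b5 := pchk_sound _ c15 s hs0 hs1
  simp only [pev_padd, pev_pmul, pev_psc, hsub, hX] at b1 b2 b4 b5
  push_cast at b1 b2
  have u1 : pev C.loc s ≤ √(x * (1 - x)) := Real.le_sqrt_of_sq_le (by rw [pow_two]; linarith)
  have u2 : √(x * (1 - x)) ≤ pev C.hi s := Real.sqrt_le_iff.2 ⟨b3, by rw [pow_two]; linarith⟩
  have u0 := Real.sqrt_nonneg (x * (1 - x))
  have key := linear_between _ _ _ _ _ u1 u2 b4 b5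
  have n1 : ((697 / 1000 : ℚ) : ℝ) = 0.697 := by norm_num
  have n2 : ((1197 / 1000 : ℚ) : ℝ) = 1.197 := by norm_num
  simp only [Cert.base, Cert.low, pev_padd, pev_psc, pev_polCubic, hsub, pev, n1, n2, mul_zero,
    add_zero] at key
  have m1 := mul_le_mul_of_nonneg_left (add_le_add a3 a4) u0
  clear a3 a4 b1 b2 b3 b4 b5 u1 u2 c7 c8 c9 c10 c11 c12 c13 c14 c15
  generalize √(x * (1 - x)) = u at *
  generalize (C.kA : ℝ) * cubic 0.697 (pev polA x / C.cA - 1) = k1 at *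
  generalize (C.kB : ℝ) * cubic 0.697 (pev polB x / C.cB - 1) = k2 at *
  generalize (C.mA : ℝ) * cubic 1.197 (pev polA x / C.cA - 1) = m1 at *
  generalize (C.mB : ℝ) * cubic 1.197 (pev polB x / C.cB - 1) = m2 at *
  generalize pev polA x ^ (0.697 : ℝ) = p1 at *
  generalize pev polB x ^ (0.697 : ℝ) = p2 at *
  generalize pev polA x ^ (1.197 : ℝ) = r1 at *
  generalize pev polB x ^ (1.197 : ℝ) = r2 at *
  push_cast at key
  linarith

def certs : List Cert := [
  ⟨0, 9/2000, 2141/1000000, 249/125, 689303/50000000, 50519/31250, 6378933/10000000000, 2281651/1000000,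
    [0], 67/1000⟩,
  ⟨9/2000, 31/5000, 929/200000, 248/125, 591329/25000000, 20151/12500, 806031/500000000, 2270687/1000000,
    [142153/6250000, 321317/25000, -2025891/2500, 121069/4], 253/100000000⟩,
  ⟨31/5000, 43/5000, 6443/1000000, 989/500, 1485609/50000000, 1608681/1000000, 476989/200000000, 2262469/1000000,
    [2674889/100000000, 109237/10000, -4992679/10000, 673573/50], 267/100000000⟩,
  ⟨43/5000, 11/1000, 8559/1000000, 1971/1000, 3621587/100000000, 1604711/1000000, 670101/200000000, 2252889/1000000,
    [308657/10000000, 591679/62500, -204286/625, 6649127/1000], 7/3125000⟩,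
  ⟨11/1000, 3/200, 57/5000, 981/500, 276403/6250000, 3999/2500, 4721881/1000000000, 2240581/1000000,
    [1774697/50000000, 8224137/1000000, -107637/500, 3298379/1000], 17/6250000⟩,
  ⟨3/200, 1/50, 1543/100000, 39/20, 2730619/50000000, 63711/40000, 3391907/500000000, 2224187/1000000,
    [4122919/100000000, 7074771/1000000, -345529/2500, 1569869/1000], 261/100000000⟩,
  ⟨1/50, 13/500, 2043/100000, 967/500, 3320681/50000000, 791827/500000, 9492731/1000000000, 55059/25000,
    [4732673/100000000, 6157383/1000000, -9206047/100000, 1587199/2000], 31/12500000⟩,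
  ⟨13/500, 33/1000, 2643/100000, 383/200, 3973487/50000000, 786397/500000, 1291963/100000000, 1088243/500000,
    [670839/12500000, 216941/40000, -6367417/100000, 2133343/5000], 237/100000000⟩,
  ⟨33/1000, 43/1000, 1721/50000, 1891/1000, 1194173/12500000, 1559029/1000000, 1772403/100000000, 535969/250000,
    [1522949/25000000, 4769187/1000000, -1098479/25000, 2277349/10000], 53/20000000⟩,
  ⟨43/1000, 7/125, 4549/100000, 1859/1000, 1160293/10000000, 1540593/1000000, 494943/20000000, 1050261/500000,
    [1392129/20000000, 4164219/1000000, -2985733/100000, 73849/625], 137/50000000⟩,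
  ⟨7/125, 71/1000, 297/5000, 1819/1000, 349357/2500000, 379353/250000, 136233/4000000, 2046537/1000000,
    [7900159/100000000, 1829533/500000, -1039013/50000, 636521/10000], 51/20000000⟩,
  ⟨71/1000, 91/1000, 7743/100000, 177/100, 1681009/10000000, 372201/250000, 4677613/100000000, 1980723/1000000,
    [2233801/25000000, 402937/125000, -293107/20000, 697447/20000], 137/50000000⟩,
  ⟨91/1000, 11/100, 4919/50000, 429/250, 124147/625000, 1456997/1000000, 3115153/50000000, 1908609/1000000,
    [4992677/50000000, 718397/250000, -269039/25000, 63757/3125], 57/25000000⟩,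
  ⟨11/100, 13/100, 601/5000, 831/500, 2283987/10000000, 712443/500000, 1979637/25000000, 1836941/1000000,
    [54683423/500000000, 1306589/500000, -8382349/1000000, 1314707/100000], 1097/500000000⟩,
  ⟨13/100, 4/25, 187/1250, 1593/1000, 2660281/10000000, 138339/100000, 1028947/10000000, 109127/62500,
    [6020947/50000000, 1180281/500000, -6454891/1000000, 4118819/500000], 31/12500000⟩,
  ⟨4/25, 1/5, 1933/10000, 1499/1000, 3180561/10000000, 1325971/1000000, 1398361/10000000, 1623433/1000000,
    [3365019/25000000, 2095921/1000000, -4805587/1000000, 1201169/250000], 11/4000000⟩,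
  ⟨1/5, 6/25, 2469/10000, 1393/1000, 471517/1250000, 629947/500000, 1874337/10000000, 743497/500000,
    [149605473/1000000000, 1869269/1000000, -3662447/1000000, 28797/10000], 2387/1000000000⟩,
  ⟨6/25, 29/100, 39/125, 1277/1000, 2220219/5000000, 118581/100000, 2480293/10000000, 1340017/1000000,
    [82564057/500000000, 335157/200000, -714347/250000, 1761513/1000000], 39/15625000⟩,
  ⟨29/100, 7/20, 3983/10000, 1139/1000, 5264373/10000000, 547479/500000, 1661199/5000000, 1168581/1000000,
    [4578657/25000000, 297937/200000, -2215727/1000000, 1022951/1000000], 129/50000000⟩,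
  ⟨7/20, 21/50, 51/100, 197/200, 1563567/2500000, 2473803/2500000, 4466439/10000000, 1964143/2000000,
    [10215963/50000000, 4089/3125, -33961/20000, 2646351/5000000], 263/100000000⟩,
  ⟨21/50, 1/2, 1303/2000, 817/1000, 3709099/5000000, 434299/500000, 5987637/10000000, 3925543/5000000,
    [115785447/500000000, 278607/250000, -1236839/1000000, 16339/100000], 1383/500000000⟩]

def chain : ℚ → List Cert → ℚ → Bool
  | l, [], r => decide (r ≤ l)
  | l, C :: cs, r => decide (C.l = l) && C.ok && chain C.h cs r

lemma chain_find (cs : List Cert) (l r : ℚ) (h : chain l cs r = true) (x : ℝ) (hl : (l : ℝ) < x)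
    (hr : x ≤ r) : ∃ C : Cert, C.ok = true ∧ (C.l : ℝ) < x ∧ x ≤ C.h := by
  induction cs generalizing l with
  | nil =>
    simp only [chain, decide_eq_true_eq] at h
    have : (r : ℝ) ≤ l := by exact_mod_cast h
    linarith
  | cons C cs ih =>
    simp only [chain, Bool.and_eq_true, decide_eq_true_eq] at h
    rcases le_or_gt x C.h with h1 | h1
    · exact ⟨C, h.1.2, by rw [h.1.1]; exact hl, h1⟩
    · exact ih _ h.2 h1

lemma certs_ok : chain 0 certs (1 / 2) = true := by decide +kernel

lemma half_case (x : ℝ) (hx0 : 0 < x) (hx1 : x ≤ 1 / 2) :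
    psi ((169 * x ^ 2 + 54 * x ^ 3 - 27 * x ^ 4) / 196)
      + psi ((392 * x - 169 * x ^ 2 - 54 * x ^ 3 + 27 * x ^ 4) / 196)
      < 2 * 0.818 * psi x := by
  obtain ⟨C, hC, h1, h2⟩ := chain_find certs 0 (1 / 2) certs_ok x (by simpa using hx0)
    (by push_cast; exact hx1)
  have eA : pev polA x
      = x * (169 + 54 * x - 27 * x ^ 2) * (196 + 196 * x + 27 * x ^ 2 - 27 * x ^ 3) / 196 ^ 2 := by
    simp only [polA, pev_psc, pev_pmul, pev]; push_cast; ring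
  have eB : pev polB x
      = (1 - x) * (392 - 169 * x - 54 * x ^ 2 + 27 * x ^ 3) * (196 - 27 * x ^ 2) / 196 ^ 2 := by
    simp only [polB, pev_psc, pev_pmul, pev]; push_cast; ring
  have q2 : x ^ 2 ≤ 1 := by nlinarith
  have q3 : 0 < x ^ 3 := by positivity
  have q3' : x ^ 3 ≤ 1 := by nlinarith
  have hA : 0 < pev polA x := by
    rw [eA]
    have e1 : 0 < 169 + 54 * x - 27 * x ^ 2 := by nlinarith
    have e2 : 0 < 196 + 196 * x + 27 * x ^ 2 - 27 * x ^ 3 := by nlinarith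
    positivity
  have hB : 0 < pev polB x := by
    rw [eB]
    have e0 : 0 < 1 - x := by linarith
    have e1 : 0 < 392 - 169 * x - 54 * x ^ 2 + 27 * x ^ 3 := by nlinarith
    have e2 : 0 < 196 - 27 * x ^ 2 := by nlinarith
    positivity
  have key := C.sound hC x h1 h2 hA hB
  have ha : 0 < x * (1 - x) := mul_pos hx0 (by linarith)
  have gA : (169 * x ^ 2 + 54 * x ^ 3 - 27 * x ^ 4) / 196 *
      (1 - (169 * x ^ 2 + 54 * x ^ 3 - 27 * x ^ 4) / 196) = x * (1 - x) * pev polA x := by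
    rw [eA]; ring
  have gB : (392 * x - 169 * x ^ 2 - 54 * x ^ 3 + 27 * x ^ 4) / 196 *
      (1 - (392 * x - 169 * x ^ 2 - 54 * x ^ 3 + 27 * x ^ 4) / 196)
      = x * (1 - x) * pev polB x := by
    rw [eB]; ring
  have split : ∀ A : ℝ, 0 < A → A ^ (1.197 : ℝ) = A ^ (0.697 : ℝ) * √A := by
    intro A hA
    rw [Real.sqrt_eq_rpow, ← Real.rpow_add hA]
    norm_num
  unfold psi
  rw [gA, gB, Real.mul_rpow ha.le hA.le, Real.mul_rpow ha.le hB.le, Real.sqrt_mul ha.le,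
    Real.sqrt_mul ha.le]
  rw [split _ hA, split _ hB] at key
  have hp : 0 < (x * (1 - x)) ^ (0.697 : ℝ) := by positivity
  have := mul_lt_mul_of_pos_left key hp
  linarith

lemma psi_symm (x : ℝ) : psi (1 - x) = psi x := by
  unfold psi
  have : (1 - x) * (1 - (1 - x)) = x * (1 - x) := by ring
  rw [this]

theorem eigenvalue_bound_explicit (x : ℝ) (hx0 : 0 < x) (hx1 : x < 1) :
    psi ((169 * x ^ 2 + 54 * x ^ 3 - 27 * x ^ 4) / 196)
      + psi ((392 * x - 169 * x ^ 2 - 54 * x ^ 3 + 27 * x ^ 4) / 196)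
      < 2 * 0.818 * psi x := by
  rcases le_or_gt x (1 / 2) with h | h
  · exact half_case x hx0 h
  · have key := half_case (1 - x) (by linarith) (by linarith)
    rw [psi_symm x] at key
    have e1 : (169 * (1 - x) ^ 2 + 54 * (1 - x) ^ 3 - 27 * (1 - x) ^ 4) / 196
        = 1 - (392 * x - 169 * x ^ 2 - 54 * x ^ 3 + 27 * x ^ 4) / 196 := by ring
    have e2 : (392 * (1 - x) - 169 * (1 - x) ^ 2 - 54 * (1 - x) ^ 3 + 27 * (1 - x) ^ 4) / 196
        = 1 - (169 * x ^ 2 + 54 * x ^ 3 - 27 * x ^ 4) / 196 := by ring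
    rw [e1, e2, psi_symm, psi_symm] at key
    linarith
end
end
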